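/- Suppose a ≠ 0, E ≠ −b and ((a+1)² − (E² − b²))·((a−1)² − (E² − b²)) > 0. Then there exists a nonzero ℓ²-solution of the half-line eigenvalue equation at energy E if and only if E = b and |a| < 1; and in that case the ℂ-vector space of ℓ²-solutions has dimension 1. -/

import Mathlib

open Matrix

noncomputable section

/-- The hopping matrix `A` with rows `(0,1)` and `(0,0)`. -/
def Amat : Matrix (Fin 2) (Fin 2) ℂ := !![0, 1; 0, 0]

/-- The on-site matrix `V` with rows `(b,a)` and `(a,-b)`. -/
def Vmat (a b : ℝ) : Matrix (Fin 2) (Fin 2) ℂ := !![(b : ℂ), (a : ℂ); (a : ℂ), -(b : ℂ)]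

/-- `ψ : ℕ → ℂ²`, where `ψ 0` represents `ψ(1)`, is a solution of the half-line
eigenvalue equation at energy `E`:
`(V - E)ψ(1) + A*ψ(2) = 0` and `Aψ(n) + (V - E)ψ(n+1) + A*ψ(n+2) = 0` for `n ≥ 1`. -/
def IsSol (a b E : ℝ) (ψ : ℕ → EuclideanSpace ℂ (Fin 2)) : Prop :=
  (Vmat a b - (E : ℂ) • 1).mulVec (ψ 0) + (Amat)ᴴ.mulVec (ψ 1) = 0 ∧
  ∀ n : ℕ, Amat.mulVec (ψ n) + (Vmat a b - (E : ℂ) • 1).mulVec (ψ (n + 1))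
      + (Amat)ᴴ.mulVec (ψ (n + 2)) = 0

/-- The ℓ² condition `∑ ‖ψ(n)‖² < ∞`. -/
def IsL2 (ψ : ℕ → EuclideanSpace ℂ (Fin 2)) : Prop :=
  Summable fun n => ‖ψ n‖ ^ 2

end

theorem isSol_iff_coords (a b E : ℝ) (ψ : ℕ → EuclideanSpace ℂ (Fin 2)) :
    IsSol a b E ψ ↔ ((a : ℂ) * ψ 0 1 = (E - b) * ψ 0 0 ∧
      (∀ n, ψ (n + 1) 0 = (E + b) * ψ n 1 - a * ψ n 0) ∧
      (∀ n, (a : ℂ) * ψ (n + 1) 1 = (E - b) * ψ (n + 1) 0 - ψ n 1)) := by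
  have key : IsSol a b E ψ ↔
      ((((b : ℂ) - E) * ψ 0 0 + a * ψ 0 1 = 0 ∧ a * ψ 0 0 + (-b - E) * ψ 0 1 + ψ 1 0 = 0) ∧
      ∀ n, (ψ n 1 + (((b : ℂ) - E) * ψ (n + 1) 0 + a * ψ (n + 1) 1) = 0 ∧
        a * ψ (n + 1) 0 + (-b - E) * ψ (n + 1) 1 + ψ (n + 2) 0 = 0)) := by
    simp [IsSol, funext_iff, Fin.forall_fin_two, Amat, Vmat, Matrix.mulVec, dotProduct,
      Fin.sum_univ_two, Matrix.conjTranspose_apply]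
  rw [key]
  constructor
  · rintro ⟨⟨h0, h1⟩, h⟩
    refine ⟨by linear_combination h0, ?_, ?_⟩
    · intro n
      cases n with
      | zero => linear_combination h1
      | succ k => linear_combination (h k).2
    · intro n
      linear_combination (h n).1
  · rintro ⟨h0, h1, h2⟩
    refine ⟨⟨by linear_combination h0, by linear_combination h1 0⟩, fun n => ⟨?_, ?_⟩⟩
    · linear_combination h2 n
    · linear_combination h1 (n + 1)

theorem coord_tendsto (ψ : ℕ → EuclideanSpace ℂ (Fin 2)) (h : IsL2 ψ) (i : Fin 2) :
    Filter.Tendsto (fun n => ψ n i) Filter.atTop (nhds 0) := by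
  have h1 : Filter.Tendsto (fun n => ‖ψ n‖ ^ 2) Filter.atTop (nhds 0) :=
    Summable.tendsto_atTop_zero h
  have h2 : Filter.Tendsto (fun n => ‖ψ n‖) Filter.atTop (nhds 0) := by
    have := h1.sqrt
    simpa [Real.sqrt_sq] using this
  exact squeeze_zero_norm (fun n => PiLp.norm_apply_le (ψ n) i) h2

theorem wronskian_zero (a b E : ℝ) (ha : a ≠ 0) (ψ : ℕ → EuclideanSpace ℂ (Fin 2))
    (h : IsSol a b E ψ) (hL : IsL2 ψ) : ((E : ℂ) - b) * ψ 0 0 ^ 2 = 0 := by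
  obtain ⟨h0, h1, h2⟩ := (isSol_iff_coords a b E ψ).1 h
  have ha' : (a : ℂ) ≠ 0 := by exact_mod_cast ha
  have hW : ∀ n, ψ n 0 * ψ (n + 1) 1 - ψ n 1 * ψ (n + 1) 0
      = ψ 0 0 * ψ 1 1 - ψ 0 1 * ψ 1 0 := by
    intro n
    induction n with
    | zero => rfl
    | succ n ih =>
      rw [← ih]
      apply mul_left_cancel₀ ha'
      linear_combination ψ (n + 1) 0 * h2 (n + 1) - ψ (n + 2) 0 * h2 n
        + ψ n 1 * h1 (n + 1) - ψ (n + 1) 1 * h1 n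
  have t0 := coord_tendsto ψ hL 0
  have t1 := coord_tendsto ψ hL 1
  have t0' := (Filter.tendsto_add_atTop_iff_nat 1).2 t0
  have t1' := (Filter.tendsto_add_atTop_iff_nat 1).2 t1
  have T := (t0.mul t1').sub (t1.mul t0')
  simp only [hW] at T
  have hz := tendsto_nhds_unique tendsto_const_nhds T
  linear_combination (-(a : ℂ) ^ 2) * hz + a * ψ 0 0 * h2 0 - a * ψ 1 0 * h0 - ψ 0 0 * h0
    + a * (E - b) * 0

theorem sol_E_eq_b (a b : ℝ) (ha : a ≠ 0) (ψ : ℕ → EuclideanSpace ℂ (Fin 2))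
    (h : IsSol a b b ψ) (n : ℕ) : ψ n 1 = 0 ∧ ψ n 0 = (-(a : ℂ)) ^ n * ψ 0 0 := by
  obtain ⟨h0, h1, h2⟩ := (isSol_iff_coords a b b ψ).1 h
  have ha' : (a : ℂ) ≠ 0 := by exact_mod_cast ha
  induction n with
  | zero =>
    refine ⟨mul_left_cancel₀ ha' (by linear_combination h0), by simp⟩
  | succ n ih =>
    refine ⟨mul_left_cancel₀ ha' (by linear_combination h2 n - ih.1), ?_⟩
    rw [h1, ih.1, ih.2]
    ring

theorem sol_zero (a b E : ℝ) (ha : a ≠ 0) (ψ : ℕ → EuclideanSpace ℂ (Fin 2))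
    (h : IsSol a b E ψ) (hx : ψ 0 0 = 0) : ψ = 0 := by
  obtain ⟨h0, h1, h2⟩ := (isSol_iff_coords a b E ψ).1 h
  have ha' : (a : ℂ) ≠ 0 := by exact_mod_cast ha
  have H : ∀ n, ψ n 0 = 0 ∧ ψ n 1 = 0 := by
    intro n
    induction n with
    | zero => exact ⟨hx, mul_left_cancel₀ ha' (by rw [h0, hx]; ring)⟩
    | succ n ih =>
      have hh : ψ (n + 1) 0 = 0 := by rw [h1, ih.1, ih.2]; ring
      exact ⟨hh, mul_left_cancel₀ ha' (by rw [h2, hh, ih.2]; ring)⟩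
  funext n
  ext i
  fin_cases i
  · exact (H n).1
  · exact (H n).2

theorem edge_state (a b : ℝ) (ha : a ≠ 0) (h1 : |a| < 1) :
      ∃ ψ₀ : ℕ → EuclideanSpace ℂ (Fin 2), ψ₀ ≠ 0 ∧ IsSol a b b ψ₀ ∧ IsL2 ψ₀ ∧
        ∀ ψ : ℕ → EuclideanSpace ℂ (Fin 2), IsSol a b b ψ → IsL2 ψ →
          ∃ c : ℂ, ψ = c • ψ₀ := by
  refine ⟨fun n => !₂[(-(a : ℂ)) ^ n, 0], ?_, ?_, ?_, ?_⟩
  · intro h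
    have := congrArg (fun v : EuclideanSpace ℂ (Fin 2) => v 0) (congrFun h 0)
    simp at this
  · rw [isSol_iff_coords]
    refine ⟨by simp, fun n => ?_, fun n => by simp⟩
    simp
    ring
  · have : (fun n : ℕ => ‖(!₂[(-(a : ℂ)) ^ n, 0] : EuclideanSpace ℂ (Fin 2))‖ ^ 2)
        = fun n => (a ^ 2) ^ n := by
      funext n
      rw [EuclideanSpace.norm_sq_eq]
      simp [Fin.sum_univ_two]
      rw [← pow_mul, ← pow_mul, mul_comm n 2, pow_mul, pow_mul, sq_abs]
    unfold IsL2
    rw [this]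
    exact summable_geometric_of_lt_one (sq_nonneg a) ((sq_lt_one_iff_abs_lt_one a).2 h1)
  · intro ψ h _
    refine ⟨ψ 0 0, ?_⟩
    funext n
    have := sol_E_eq_b a b ha ψ h n
    ext i
    fin_cases i
    · simp [this.2, mul_comm]
    · simp [this.1]

/-- For `a ≠ 0`, `E ≠ -b` and positive discriminant: a nonzero ℓ²-solution exists iff
`E = b` and `|a| < 1`, in which case the space of ℓ²-solutions has dimension 1. -/
theorem L2_solution_positive_discriminant (a b E : ℝ) (ha : a ≠ 0) (hE : E ≠ -b)
    (hΔ : 0 < ((a + 1) ^ 2 - (E ^ 2 - b ^ 2)) * ((a - 1) ^ 2 - (E ^ 2 - b ^ 2))) :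
    ((∃ ψ : ℕ → EuclideanSpace ℂ (Fin 2), IsSol a b E ψ ∧ IsL2 ψ ∧ ψ ≠ 0) ↔
      (E = b ∧ |a| < 1)) ∧
    (E = b → |a| < 1 →
      ∃ ψ₀ : ℕ → EuclideanSpace ℂ (Fin 2), ψ₀ ≠ 0 ∧ IsSol a b E ψ₀ ∧ IsL2 ψ₀ ∧
        ∀ ψ : ℕ → EuclideanSpace ℂ (Fin 2), IsSol a b E ψ → IsL2 ψ →
          ∃ c : ℂ, ψ = c • ψ₀) := by
  constructor
  · constructor
    · rintro ⟨ψ, h, hL, hne⟩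
      have hx : ψ 0 0 ≠ 0 := fun hx => hne (sol_zero a b E ha ψ h hx)
      have hw := wronskian_zero a b E ha ψ h hL
      have ht : (E : ℂ) - b = 0 := by
        rcases mul_eq_zero.1 hw with h | h
        · exact h
        · exact absurd (pow_eq_zero_iff (two_ne_zero) |>.1 h) hx
      have hEb : E = b := by exact_mod_cast sub_eq_zero.1 ht
      refine ⟨hEb, ?_⟩
      subst hEb
      have T := (coord_tendsto ψ hL 0).norm
      by_contra hlt
      push Not at hlt
      have hge : ∀ n, ‖ψ 0 0‖ ≤ ‖ψ n 0‖ := by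
        intro n
        rw [(sol_E_eq_b a E ha ψ h n).2, norm_mul, norm_pow, norm_neg, Complex.norm_real,
          Real.norm_eq_abs]
        exact le_mul_of_one_le_left (norm_nonneg _) (one_le_pow₀ hlt)
      have := ge_of_tendsto' T hge
      rw [norm_zero] at this
      exact hx (norm_le_zero_iff.1 this)
    · rintro ⟨rfl, h1⟩
      obtain ⟨ψ, h0, hs, hL, _⟩ := edge_state a E ha h1
      exact ⟨ψ, hs, hL, h0⟩
  · rintro rfl h1
    exact edge_state a E ha h1
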